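/- Let Mon be a set of words closed under taking subwords. If U is a subword of a word W, then MinCov(U) ≤ MinCov(W); that is, MinCov does not increase when passing to a subword. -/

import Mathlib

/-- A *word*: a list of letters, where a letter is a free generator of the free group `F`
together with a sign (`true` for the generator, `false` for its inverse). -/
abbrev Word (α : Type*) := List (α × Bool)

/-- A word is *reduced* if no two adjacent letters cancel. -/
def Reduced {α : Type*} (w : Word α) : Prop :=
  w.Chain' fun a b => ¬(a.1 = b.1 ∧ a.2 = !b.2)

/-- A word is *cyclically reduced* if it is reduced and its last letter is not the inverse of
its first letter; equivalently, `w ++ w` is reduced. -/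
def CyclicallyReduced {α : Type*} (w : Word α) : Prop := Reduced (w ++ w)

/-- A set of words is closed under taking subwords. -/
def SubwordClosed {α : Type*} (M : Set (Word α)) : Prop :=
  ∀ w ∈ M, ∀ u : Word α, u <:+: w → u ∈ M

/-- `Occurs u A i` : the word `u` occurs in the word `A` starting at position `i`.
An *occurrence* of `u` in `A` is such a pair `(i, u)`. -/
def Occurs {α : Type*} (u A : Word α) (i : ℕ) : Prop :=
  ∃ L R : Word α, A = L ++ u ++ R ∧ L.length = i

/-- The occurrence of `u` at position `i` is contained in the occurrence of `v` at position `j`. -/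
def OccContained {α : Type*} (i : ℕ) (u : Word α) (j : ℕ) (v : Word α) : Prop :=
  j ≤ i ∧ i + u.length ≤ j + v.length

/-- `IsMaxOcc M A i u` : `(i, u)` is a *maximal occurrence* in `A` with respect to `M`:
an occurrence of an element of `M` in `A` that is not properly contained in any other
occurrence of an element of `M` in `A`. -/
def IsMaxOcc {α : Type*} (M : Set (Word α)) (A : Word α) (i : ℕ) (u : Word α) : Prop :=
  u ∈ M ∧ Occurs u A i ∧
    ∀ j v, v ∈ M → Occurs v A j → OccContained i u j v → i = j ∧ u = v

/-- The letter at position `j` of `A` is covered by some occurrence of an element of `M`. -/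
def Covered {α : Type*} (M : Set (Word α)) (A : Word α) (j : ℕ) : Prop :=
  ∃ (i : ℕ) (u : Word α), u ∈ M ∧ Occurs u A i ∧ i ≤ j ∧ j < i + u.length

/-- `MinCov M A`: the minimal number of maximal occurrences (with respect to `M`) in `A`
needed to cover all letters of `A` that belong to some occurrence of an element of `M`. -/
noncomputable def MinCov {α : Type*} (M : Set (Word α)) (A : Word α) : ℕ :=
  sInf { n | ∃ T : Finset (ℕ × Word α), (∀ o ∈ T, IsMaxOcc M A o.1 o.2) ∧ T.card = n ∧
    ∀ j, Covered M A j → ∃ o ∈ T, o.1 ≤ j ∧ j < o.1 + o.2.length }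

/-- An occurrence at position `i` is cut out of the ambient word by `drop` and `take`. -/
theorem occurs_iff {α : Type*} {u A : Word α} {i : ℕ} :
    Occurs u A i ↔ i + u.length ≤ A.length ∧ (A.drop i).take u.length = u := by
  constructor
  · rintro ⟨L, R, rfl, rfl⟩
    simp
  · rintro ⟨h, hu⟩
    refine ⟨A.take i, (A.drop i).drop u.length, ?_, ?_⟩
    · have huR := List.take_append_drop u.length (A.drop i)
      rw [hu] at huR
      rw [List.append_assoc, huR, List.take_append_drop]
    · simp
      omega

/-- Every occurrence of an element of `M` is contained in a maximal one. -/
theorem exists_isMaxOcc {α : Type*} {M : Set (Word α)} {A u : Word α} {i : ℕ}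
    (hu : u ∈ M) (ho : Occurs u A i) :
    ∃ j v, IsMaxOcc M A j v ∧ OccContained i u j v := by
  induction h : A.length - u.length using Nat.strong_induction_on generalizing i u with
  | _ n ih =>
    by_cases hmax : IsMaxOcc M A i u
    · exact ⟨i, u, hmax, le_rfl, le_rfl⟩
    · simp only [IsMaxOcc, not_and, not_forall] at hmax
      obtain ⟨j, v, hv, hov, hc, hne⟩ := hmax hu ho
      obtain ⟨h₁, h₂⟩ := hc
      have hu' := occurs_iff.1 ho
      have hv' := occurs_iff.1 hov
      have hlt : u.length < v.length := by
        by_contra hle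
        have hij : i = j := by omega
        have hlen : u.length = v.length := by omega
        exact hne hij (by rw [← hu'.2, ← hv'.2, hij, hlen])
      obtain ⟨k, w, hw, hk₁, hk₂⟩ := ih (A.length - v.length) (by omega) hv hov rfl
      exact ⟨k, w, hw, by omega, by omega⟩

/-- Finitely many maximal occurrences in `A` cover all covered letters. -/
theorem exists_finset_cover {α : Type*} (M : Set (Word α)) (A : Word α) :
    ∃ T : Finset (ℕ × Word α), (∀ o ∈ T, IsMaxOcc M A o.1 o.2) ∧
      ∀ j, Covered M A j → ∃ o ∈ T, o.1 ≤ j ∧ j < o.1 + o.2.length := by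
  classical
  have key : ∀ j, ∃ F : Finset (ℕ × Word α), (∀ o ∈ F, IsMaxOcc M A o.1 o.2) ∧
      (Covered M A j → ∃ o ∈ F, o.1 ≤ j ∧ j < o.1 + o.2.length) := by
    intro j
    by_cases hj : Covered M A j
    · obtain ⟨i, u, hu, ho, h₁, h₂⟩ := hj
      obtain ⟨k, v, hv, hk₁, hk₂⟩ := exists_isMaxOcc hu ho
      exact ⟨{(k, v)}, by simpa using hv, fun _ => ⟨(k, v), by simp, by dsimp; omega,
        by dsimp; omega⟩⟩
    · exact ⟨∅, by simp, fun h => absurd h hj⟩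
  choose F hF hcov using key
  refine ⟨(Finset.range A.length).biUnion F, ?_, ?_⟩
  · intro o ho
    obtain ⟨j, -, hj⟩ := Finset.mem_biUnion.1 ho
    exact hF j o hj
  · intro j hj
    obtain ⟨o, ho, h⟩ := hcov j hj
    obtain ⟨i, u, -, hou, h₁, h₂⟩ := hj
    have := (occurs_iff.1 hou).1
    exact ⟨o, Finset.mem_biUnion.2 ⟨j, Finset.mem_range.2 (by omega), ho⟩, h⟩

/-- An occurrence in a word extends to an occurrence in any larger word. -/
theorem Occurs.append {α : Type*} {u U : Word α} {i : ℕ} (h : Occurs u U i) (P S : Word α) :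
    Occurs u (P ++ U ++ S) (P.length + i) := by
  obtain ⟨L, R, rfl, rfl⟩ := h
  exact ⟨P ++ L, R ++ S, by simp, by simp⟩

/-- The intersection of an occurrence in `P ++ U ++ S` with `U` is an occurrence in `U` of a
subword. -/
theorem Occurs.restrict {α : Type*} {v P U S : Word α} {i j : ℕ}
    (h : Occurs v (P ++ U ++ S) i) (hj : j < U.length) (h₁ : i ≤ P.length + j) :
    ∃ k u, u <:+: v ∧ Occurs u U k ∧ ∀ l < U.length,
      i ≤ P.length + l → P.length + l < i + v.length → k ≤ l ∧ l < k + u.length := by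
  obtain ⟨hlen, hv⟩ := occurs_iff.1 h
  simp only [List.length_append] at hlen
  let d := P.length - i
  let k := i - P.length
  let n := min (v.length - d) (U.length - k)
  have hu : (v.drop d).take n = (U.drop k).take n := by
    apply List.ext_getElem?
    intro m
    rw [List.getElem?_take, List.getElem?_take]
    split_ifs with hm
    · have hmv : d + m < v.length := by omega
      have hmU : k + m < U.length := by omega
      rw [List.getElem?_drop, List.getElem?_drop, ← hv, List.getElem?_take, if_pos hmv,
        List.getElem?_drop, List.append_assoc, List.getElem?_append_right (by omega),
        List.getElem?_append_left (by omega)]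
      congr 1
      omega
    · rfl
  have hn : ((U.drop k).take n).length = n := by
    simp only [List.length_take, List.length_drop]
    omega
  refine ⟨k, (U.drop k).take n, ?_, occurs_iff.2 ⟨by omega, by rw [hn]⟩, ?_⟩
  · rw [← hu]
    exact (List.take_prefix _ _).isInfix.trans (List.drop_suffix _ _).isInfix
  · intro l hl hl₁ hl₂
    rw [hn]
    omega

/-- Let `Mon` be subword-closed. If `U` is a subword of a (reduced) word
`W`, then `MinCov(U) ≤ MinCov(W)`: `MinCov` does not increase when passing to a subword. -/
theorem minCov_subword {α : Type*} (Mon : Set (Word α)) (hMon : SubwordClosed Mon)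
    (W U : Word α) (hW : Reduced W) (hU : U <:+: W) :
    MinCov Mon U ≤ MinCov Mon W := by
  classical
  obtain ⟨P, S, rfl⟩ := hU
  obtain ⟨T₀, hT₀, hcov₀⟩ := exists_finset_cover Mon (P ++ U ++ S)
  obtain ⟨T, hT, hcard, hcov⟩ := Nat.sInf_mem (s := { n | ∃ T : Finset (ℕ × Word α),
    (∀ o ∈ T, IsMaxOcc Mon (P ++ U ++ S) o.1 o.2) ∧ T.card = n ∧
    ∀ j, Covered Mon (P ++ U ++ S) j → ∃ o ∈ T, o.1 ≤ j ∧ j < o.1 + o.2.length })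
    ⟨T₀.card, T₀, hT₀, rfl, hcov₀⟩
  have key : ∀ o : ℕ × Word α, ∃ F : Finset (ℕ × Word α), F.card ≤ 1 ∧
      (∀ q ∈ F, IsMaxOcc Mon U q.1 q.2) ∧
      (o ∈ T → ∀ l < U.length, o.1 ≤ P.length + l → P.length + l < o.1 + o.2.length →
        ∃ q ∈ F, q.1 ≤ l ∧ l < q.1 + q.2.length) := by
    intro o
    by_cases ho : o ∈ T ∧ ∃ j < U.length, o.1 ≤ P.length + j
    · obtain ⟨hoT, j, hj, h₁⟩ := ho
      obtain ⟨k, u, huv, hou, hk⟩ := (hT o hoT).2.1.restrict hj h₁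
      obtain ⟨m, w, hw, hm₁, hm₂⟩ := exists_isMaxOcc (hMon _ (hT o hoT).1 u huv) hou
      refine ⟨{(m, w)}, by simp, by simpa using hw, fun _ l hl hl₁ hl₂ => ⟨(m, w), by simp, ?_⟩⟩
      have := hk l hl hl₁ hl₂
      dsimp
      omega
    · exact ⟨∅, by simp, by simp, fun hoT l hl hl₁ _ => absurd ⟨hoT, l, hl, hl₁⟩ ho⟩
  choose F hF₁ hF hFcov using key
  refine le_trans (Nat.sInf_le ⟨T.biUnion F, ?_, rfl, ?_⟩) ?_
  · intro q hq
    obtain ⟨o, -, ho⟩ := Finset.mem_biUnion.1 hq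
    exact hF o q ho
  · rintro j ⟨i, u, hu, hou, h₁, h₂⟩
    have hlen := (occurs_iff.1 hou).1
    obtain ⟨o, hoT, ho₁, ho₂⟩ := hcov (P.length + j)
      ⟨P.length + i, u, hu, hou.append P S, by omega, by omega⟩
    obtain ⟨q, hq, h⟩ := hFcov o hoT j (by omega) ho₁ ho₂
    exact ⟨q, Finset.mem_biUnion.2 ⟨o, hoT, hq⟩, h⟩
  · calc (T.biUnion F).card ≤ T.card * 1 := Finset.card_biUnion_le_card_mul _ _ _ fun o _ => hF₁ o
      _ = MinCov Mon (P ++ U ++ S) := by rw [mul_one, hcard]; rfl
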